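/- Let ρ be a density matrix on ℂ^d ⊗ ℂ^n. Then there exist a family of d² Hermitian, unit-trace d×d matrices {Q_α}_{α=1,…,d²} (depending only on a fixed informationally complete POVM, not on ρ), nonnegative weights {w_α} summing to 1, and density matrices {ρ_α} on ℂ^n (both depending on ρ), such that for every unitary U on ℂ^d ⊗ ℂ^n the reduced state satisfies Tr_B[U ρ U†] = Σ_α w_α · Tr_B[U (Q_α ⊗ ρ_α) U†]. That is, the reduced dynamics is described by at most d² maps of the form φ_U^{(α)}(X) := Tr_B[U (X ⊗ ρ_α) U†], each generated by a bona fide bath density matrix ρ_α. -/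

import Mathlib

open Matrix
open scoped Kronecker ComplexOrder

/-- Partial trace over the second (bath) factor. -/
noncomputable def trB {d n : ℕ} (M : Matrix (Fin d × Fin n) (Fin d × Fin n) ℂ) :
    Matrix (Fin d) (Fin d) ℂ :=
  Matrix.of fun s s' => ∑ b : Fin n, M (s, b) (s', b)

section BasisExistence
open scoped Matrix.Norms.L2Operator MatrixOrder

/-- A basis of positive semidefinite matrices, one of which is the identity. -/
lemma exists_psd_basis (d : ℕ) (hd : 0 < d) :
    ∃ (v : Module.Basis (Fin (d ^ 2)) ℂ (Matrix (Fin d) (Fin d) ℂ)) (a : Fin (d ^ 2)),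
      v a = 1 ∧ ∀ α, (v α).PosSemidef := by
  have : Nonempty (Fin d) := ⟨⟨0, hd⟩⟩
  have hli : LinearIndepOn ℂ id ({1} : Set (Matrix (Fin d) (Fin d) ℂ)) := by
    apply LinearIndepOn.singleton
    exact one_ne_zero
  have hsub : ({1} : Set (Matrix (Fin d) (Fin d) ℂ)) ⊆ {a | 0 ≤ a} := by
    intro x hx
    rw [Set.mem_singleton_iff] at hx
    subst hx
    exact Matrix.nonneg_iff_posSemidef.mpr Matrix.PosSemidef.one
  obtain ⟨b, hb1, hb2, hb3, hb4⟩ := exists_linearIndepOn_id_extension hli hsub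
  have hspan : (⊤ : Submodule ℂ (Matrix (Fin d) (Fin d) ℂ)) ≤ Submodule.span ℂ b := by
    rw [← CStarAlgebra.span_nonneg (A := Matrix (Fin d) (Fin d) ℂ)]
    exact Submodule.span_le.mpr hb3
  let B : Module.Basis b ℂ (Matrix (Fin d) (Fin d) ℂ) :=
    Module.Basis.mk (v := fun x : b => (x : Matrix (Fin d) (Fin d) ℂ)) hb4 (by simpa using hspan)
  have : Fintype b := FiniteDimensional.fintypeBasisIndex B
  have hcard : Fintype.card b = Fintype.card (Fin (d ^ 2)) := by
    rw [← Module.finrank_eq_card_basis B, Module.finrank_matrix]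
    simp [sq]
  let e := Fintype.equivOfCardEq hcard
  have h1 : (1 : Matrix (Fin d) (Fin d) ℂ) ∈ b := hb2 rfl
  refine ⟨B.reindex e, e ⟨1, h1⟩, by rw [Module.Basis.reindex_apply, Equiv.symm_apply_apply]; exact Module.Basis.mk_apply _ _ _, fun α => ?_⟩
  have : 0 ≤ (B.reindex e) α := by
    rw [Module.Basis.reindex_apply]
    refine le_of_le_of_eq (hb1 (e.symm α).2) ?_
    exact (Module.Basis.mk_apply _ _ _).symm
  exact Matrix.nonneg_iff_posSemidef.mp this

lemma exists_scale {d : ℕ} (S : Matrix (Fin d) (Fin d) ℂ) (hS : S.PosSemidef) :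
    ∃ c : ℝ, 0 < c ∧ (1 - (c : ℂ) • S).PosSemidef := by
  have hp : 0 < ‖S‖ + 1 := by positivity
  refine ⟨(‖S‖ + 1)⁻¹, inv_pos.mpr hp, ?_⟩
  have h1 : S ≤ algebraMap ℝ _ ‖S‖ := IsSelfAdjoint.le_algebraMap_norm_self (a := S) hS.1
  have h2 := Matrix.le_iff.mp h1
  have h3 : ((((‖S‖ + 1)⁻¹ : ℝ) : ℂ) •
      ((algebraMap ℝ (Matrix (Fin d) (Fin d) ℂ) ‖S‖ - S) + 1)).PosSemidef := by
    apply Matrix.PosSemidef.smul (h2.add Matrix.PosSemidef.one)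
    exact_mod_cast (inv_pos.mpr hp).le
  convert h3 using 1
  have hne : ((‖S‖ : ℂ) + 1) ≠ 0 := by exact_mod_cast hp.ne'
  ext i j
  by_cases hij : i = j
  · subst hij
    simp [Matrix.algebraMap_matrix_apply]
    field_simp
    ring
  · simp [Matrix.algebraMap_matrix_apply, hij]

end BasisExistence

/-- An informationally complete POVM with `d ^ 2` elements. -/
lemma exists_ic_povm (d : ℕ) (hd : 0 < d) :
    ∃ P : Module.Basis (Fin (d ^ 2)) ℂ (Matrix (Fin d) (Fin d) ℂ),
      (∀ α, (P α).PosSemidef) ∧ ∑ α, P α = 1 := by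
  obtain ⟨v, a, ha, hv⟩ := exists_psd_basis d hd
  obtain ⟨c, hc, hS⟩ := exists_scale (∑ β ∈ Finset.univ.erase a, v β)
    (Matrix.posSemidef_sum _ fun i _ => hv i)
  have hc' : (c : ℂ) ≠ 0 := by exact_mod_cast hc.ne'
  let P : Fin (d ^ 2) → Matrix (Fin d) (Fin d) ℂ := fun α =>
    if α = a then 1 - (c : ℂ) • ∑ β ∈ Finset.univ.erase a, v β else (c : ℂ) • v α
  have hsum : ∑ α, P α = 1 := by
    rw [← Finset.add_sum_erase _ _ (Finset.mem_univ a)]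
    have : ∑ x ∈ Finset.univ.erase a, P x = ∑ x ∈ Finset.univ.erase a, (c : ℂ) • v x := by
      apply Finset.sum_congr rfl
      intro x hx
      simp [P, Finset.ne_of_mem_erase hx]
    rw [this, ← Finset.smul_sum]
    simp [P]
  have hspan : ⊤ ≤ Submodule.span ℂ (Set.range P) := by
    rw [← v.span_eq, Submodule.span_le]
    rintro _ ⟨α, rfl⟩
    by_cases h : α = a
    · subst h
      rw [ha, ← hsum]
      exact Submodule.sum_mem _ fun i _ => Submodule.subset_span ⟨i, rfl⟩
    · have : v α = (c : ℂ)⁻¹ • P α := by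
        simp only [P, h, if_false]
        rw [smul_smul, inv_mul_cancel₀ hc', one_smul]
      rw [this]
      exact Submodule.smul_mem _ _ (Submodule.subset_span ⟨α, rfl⟩)
  refine ⟨basisOfTopLeSpanOfCardEqFinrank P hspan ?_, ?_, ?_⟩
  · rw [Module.finrank_matrix]; simp [sq]
  · intro α
    rw [coe_basisOfTopLeSpanOfCardEqFinrank]
    by_cases h : α = a
    · simpa [P, h] using hS
    · simp only [P, h, if_false]
      exact (hv α).smul (by exact_mod_cast hc.le)
  · rw [coe_basisOfTopLeSpanOfCardEqFinrank]; exact hsum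

/-- The unnormalised bath state `Tr_S[(P ⊗ 1) ρ]`. -/
noncomputable def bathState {d n : ℕ} (P : Matrix (Fin d) (Fin d) ℂ)
    (ρ : Matrix (Fin d × Fin n) (Fin d × Fin n) ℂ) : Matrix (Fin n) (Fin n) ℂ :=
  Matrix.of fun b b' => ∑ s, ∑ s', P s' s * ρ (s, b) (s', b')

open scoped Matrix.Norms.L2Operator MatrixOrder in
lemma bathState_posSemidef {d n : ℕ} {P : Matrix (Fin d) (Fin d) ℂ}
    {ρ : Matrix (Fin d × Fin n) (Fin d × Fin n) ℂ} (hP : P.PosSemidef) (hρ : ρ.PosSemidef) :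
    (bathState P ρ).PosSemidef := by
  obtain ⟨C, rfl⟩ := CStarAlgebra.nonneg_iff_eq_star_mul_self.mp (Matrix.nonneg_iff_posSemidef.mpr hP)
  let W : Fin d → Matrix (Fin n) (Fin d × Fin n) ℂ := fun k =>
    Matrix.of fun b p => if b = p.2 then C k p.1 else 0
  have : bathState (star C * C) ρ = ∑ k, W k * ρ * (W k)ᴴ := by
    ext b b'
    simp only [bathState, Matrix.star_eq_conjTranspose, Matrix.of_apply, Matrix.sum_apply,
      Matrix.mul_apply, W,
      Matrix.conjTranspose_apply, Fintype.sum_prod_type, ite_mul, zero_mul, apply_ite star,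
      star_zero, mul_ite, mul_zero, Finset.sum_ite_eq, Finset.mem_univ, if_true, Finset.sum_mul]
    rw [Finset.sum_congr rfl fun s _ => Finset.sum_comm, Finset.sum_comm]
    refine Finset.sum_congr rfl fun k _ => ?_
    rw [Finset.sum_comm]
    refine Finset.sum_congr rfl fun s' _ => ?_
    refine Finset.sum_congr rfl fun s _ => ?_
    ring
  rw [this]
  exact Matrix.posSemidef_sum _ fun k _ => hρ.mul_mul_conjTranspose_same (W k)

lemma normalise {n : ℕ} (hn : 0 < n) {τ : Matrix (Fin n) (Fin n) ℂ} (h : τ.PosSemidef) :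
    ∃ σ : Matrix (Fin n) (Fin n) ℂ, (σ.PosSemidef ∧ σ.trace = 1) ∧
      0 ≤ τ.trace.re ∧ ((τ.trace.re : ℝ) : ℂ) = τ.trace ∧ τ = ((τ.trace.re : ℝ) : ℂ) • σ := by
  have h0 := h.trace_nonneg
  have hre : ((τ.trace.re : ℝ) : ℂ) = τ.trace := (Complex.eq_re_of_ofReal_le h0).symm
  have hre0 : 0 ≤ τ.trace.re := (Complex.le_def.mp h0).1
  rw [hre]
  by_cases ht : τ.trace = 0
  · have hτ : τ = 0 := h.trace_eq_zero_iff.mp ht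
    have hn' : (n : ℂ) ≠ 0 := by exact_mod_cast hn.ne'
    refine ⟨(n : ℂ)⁻¹ • 1, ⟨Matrix.PosSemidef.one.smul ?_, ?_⟩, hre0, rfl, ?_⟩
    · have : (0 : ℝ) ≤ (n : ℝ)⁻¹ := by positivity
      have h2 : (0 : ℂ) ≤ (((n : ℝ)⁻¹ : ℝ) : ℂ) := by exact_mod_cast this
      simpa using h2
    · simp [Matrix.trace_smul, hn']
    · simp [hτ]
  · refine ⟨τ.trace⁻¹ • τ, ⟨h.smul ?_, ?_⟩, hre0, rfl, ?_⟩
    · rw [← hre]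
      exact_mod_cast inv_nonneg.mpr hre0
    · simp [Matrix.trace_smul, ht]
    · simp [smul_smul, ht]

lemma trB_sum {d n : ℕ} {ι : Type*} (s : Finset ι)
    (M : ι → Matrix (Fin d × Fin n) (Fin d × Fin n) ℂ) :
    trB (∑ i ∈ s, M i) = ∑ i ∈ s, trB (M i) := by
  ext a b
  simp only [trB, Matrix.of_apply, Matrix.sum_apply]
  exact Finset.sum_comm

lemma trB_smul {d n : ℕ} (c : ℂ) (M : Matrix (Fin d × Fin n) (Fin d × Fin n) ℂ) :
    trB (c • M) = c • trB M := by
  ext a b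
  simp [trB, Finset.mul_sum]

/-- There is a fixed family of `d²` Hermitian unit-trace matrices `{Q_α}` (independent of the
state) such that every density matrix `ρ` on `ℂ^d ⊗ ℂ^n` admits nonnegative weights `{w_α}`
summing to `1` and bath density matrices `{ρ_α}` with
`Tr_B[U ρ U†] = Σ_α w_α Tr_B[U (Q_α ⊗ ρ_α) U†]` for every unitary `U`: the reduced dynamics
is described by at most `d²` maps `φ_U^{(α)}(X) = Tr_B[U (X ⊗ ρ_α) U†]`, each generated by a
bona fide bath density matrix. -/
theorem reduced_dynamics_by_d_sq_maps (d n : ℕ) :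
    ∃ Q : Fin (d ^ 2) → Matrix (Fin d) (Fin d) ℂ,
      (∀ α, (Q α).IsHermitian) ∧ (∀ α, Matrix.trace (Q α) = 1) ∧
      ∀ ρ : Matrix (Fin d × Fin n) (Fin d × Fin n) ℂ, ρ.PosSemidef → ρ.trace = 1 →
        ∃ (w : Fin (d ^ 2) → ℝ) (σ : Fin (d ^ 2) → Matrix (Fin n) (Fin n) ℂ),
          (∀ α, 0 ≤ w α) ∧ (∑ α, w α = 1) ∧
          (∀ α, (σ α).PosSemidef ∧ (σ α).trace = 1) ∧
          ∀ U : Matrix (Fin d × Fin n) (Fin d × Fin n) ℂ,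
            U ∈ Matrix.unitaryGroup (Fin d × Fin n) ℂ →
            trB (U * ρ * Uᴴ) = ∑ α, (w α : ℂ) • trB (U * ((Q α) ⊗ₖ (σ α)) * Uᴴ) := by
  rcases Nat.eq_zero_or_pos d with rfl | hd
  · refine ⟨fun _ => 0, fun α => α.elim0, fun α => α.elim0, fun ρ _ h => ?_⟩
    simp [Matrix.trace] at h
  obtain ⟨P, hP, hsum⟩ := exists_ic_povm d hd
  let Q : Fin (d ^ 2) → Matrix (Fin d) (Fin d) ℂ := fun α =>
    Matrix.of fun s s' => P.repr (Matrix.single s' s 1) α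
  have hQ : ∀ s s', ∑ α, Q α s s' • P α = Matrix.single s' s 1 := fun s s' =>
    P.sum_repr (Matrix.single s' s 1)
  refine ⟨Q, ?_, ?_, ?_⟩
  · intro α
    ext s s'
    have h := congrArg Matrix.conjTranspose (hQ s' s)
    rw [Matrix.conjTranspose_sum] at h
    simp only [Matrix.conjTranspose_smul, (hP _).1.eq, Matrix.conjTranspose_single,
      star_one] at h
    have h2 := congrArg (fun M => P.repr M α) h
    simp only [P.repr_sum_self] at h2
    exact h2
  · intro α
    have h1 : (1 : Matrix (Fin d) (Fin d) ℂ) = ∑ s, Matrix.single s s 1 := by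
      ext i j
      simp only [Matrix.sum_apply, Matrix.single_apply, Matrix.one_apply, ite_and]
      simp
    have h2 : P.repr (1 : Matrix (Fin d) (Fin d) ℂ) α = 1 := by
      rw [← hsum]
      have := P.repr_sum_self (fun _ => (1 : ℂ))
      simp only [one_smul] at this
      exact congrFun this α
    rw [h1, map_sum, Finsupp.finsetSum_apply] at h2
    exact h2
  · intro ρ hρ htr
    have hn : 0 < n := by
      rcases Nat.eq_zero_or_pos n with rfl | h
      · simp [Matrix.trace] at htr
      · exact h
    choose σ hσ hw hre hτ using fun α => normalise hn (bathState_posSemidef (hP α) hρ)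
    refine ⟨fun α => (bathState (P α) ρ).trace.re, σ, hw, ?_, hσ, ?_⟩
    · have : ∑ α, (bathState (P α) ρ).trace = 1 := by
        rw [← Matrix.trace_sum]
        have h : ∑ α, bathState (P α) ρ = bathState 1 ρ := by
          ext b b'
          simp only [bathState, Matrix.sum_apply, Matrix.of_apply]
          rw [Finset.sum_comm]
          refine Finset.sum_congr rfl fun s _ => ?_
          rw [Finset.sum_comm]
          refine Finset.sum_congr rfl fun s' _ => ?_
          rw [← Finset.sum_mul, ← Matrix.sum_apply, hsum]
        rw [h, ← htr]
        simp only [bathState, Matrix.trace, Matrix.diag, Matrix.of_apply, Matrix.one_apply,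
          ite_mul, one_mul, zero_mul, Finset.sum_ite_eq', Finset.mem_univ, if_true,
          Fintype.sum_prod_type]
        exact Finset.sum_comm
      rw [← Complex.re_sum, this, Complex.one_re]
    · intro U _
      have hdec : ρ = ∑ α, (((bathState (P α) ρ).trace.re : ℝ) : ℂ) • (Q α ⊗ₖ σ α) := by
        have h : ∀ α, (((bathState (P α) ρ).trace.re : ℝ) : ℂ) • (Q α ⊗ₖ σ α)
            = Q α ⊗ₖ bathState (P α) ρ := by
          intro α
          rw [← Matrix.kronecker_smul, ← hτ α]
        simp only [h]
        ext ⟨t, b⟩ ⟨t', b'⟩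
        simp only [Matrix.sum_apply, Matrix.kroneckerMap_apply, bathState, Matrix.of_apply,
          Finset.mul_sum]
        have key : ∀ s s', ∑ α, Q α t t' * P α s' s = (Matrix.single t' t (1 : ℂ)) s' s := by
          intro s s'
          rw [← hQ t t']
          simp [Matrix.sum_apply]
        rw [Finset.sum_comm]
        have : ∀ s, ∑ α, ∑ s', Q α t t' * (P α s' s * ρ (s, b) (s', b'))
            = ∑ s', (Matrix.single t' t (1 : ℂ)) s' s * ρ (s, b) (s', b') := by
          intro s
          rw [Finset.sum_comm]
          refine Finset.sum_congr rfl fun s' _ => ?_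
          rw [← key, Finset.sum_mul]
          exact Finset.sum_congr rfl fun α _ => by ring
        simp only [this, Matrix.single_apply, ite_and]
        simp
      conv_lhs => rw [hdec]
      rw [Matrix.mul_sum, Matrix.sum_mul, trB_sum]
      refine Finset.sum_congr rfl fun α _ => ?_
      rw [Matrix.mul_smul, Matrix.smul_mul, trB_smul]
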